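/- arXiv:2112.00320 — 7 statements merged into one kernel-verified Lean document; each statement's English description precedes it below -/
import Mathlib

section
/- Let a ≤ b be natural numbers and let X and Y be feasible schedules on [a,b] satisfying: (i) if X is nonempty then Y is nonempty and the smallest start time of an assignment interval of Y is at most the smallest start time of an assignment interval of X; (ii) whenever the start time s of an assignment interval (s,t,p) of Y satisfies s' ≤ s ≤ t' for some assignment interval (s',t',p') of X, then t ≥ t'; (iii) for every time step u with a ≤ u ≤ b, if some assignment interval of X contains u then some assignment interval of Y contains u. Then for every natural number j with 0 ≤ j ≤ b − a, λ(X, a, a+j) ≤ λ(Y, a, a+j). -/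
open scoped Classical

/-- A feasible schedule on `[a,b]`: a finite set of assignment intervals `(s,t,p)` with
`a ≤ s ≤ t ≤ b`, with `p` allowed at every time step of `[s,t]`, and with the time
intervals of distinct triples pairwise disjoint. -/
def Feasible {P : Type*} (L : ℕ → Finset P) (a b : ℕ) (C : Finset (ℕ × ℕ × P)) : Prop :=
  (∀ x ∈ C, a ≤ x.1 ∧ x.1 ≤ x.2.1 ∧ x.2.1 ≤ b ∧ ∀ j, x.1 ≤ j → j ≤ x.2.1 → x.2.2 ∈ L j) ∧
  ∀ x ∈ C, ∀ y ∈ C, x ≠ y → ∀ j, x.1 ≤ j → j ≤ x.2.1 → ¬ (y.1 ≤ j ∧ j ≤ y.2.1)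

/-- The stability value `λ(C, a, c)`: `Δ` times the number of time steps `t` with
`a ≤ t < c` for which some assignment interval `(s,t',p) ∈ C` satisfies `s ≤ t` and
`t + 1 ≤ t'`. -/
noncomputable def stab {P : Type*} (Δ : ℝ) (C : Finset (ℕ × ℕ × P)) (a c : ℕ) : ℝ :=
  Δ * ((Finset.Ico a c).filter fun t => ∃ x ∈ C, x.1 ≤ t ∧ t + 1 ≤ x.2.1).card

theorem Feasible.eq_of_mem {P : Type*} {L : ℕ → Finset P} {a b : ℕ} {C : Finset (ℕ × ℕ × P)}
    (hC : Feasible L a b C) {x y : ℕ × ℕ × P} (hx : x ∈ C) (hy : y ∈ C) {j : ℕ}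
    (hxs : x.1 ≤ j) (hxt : j ≤ x.2.1) (hys : y.1 ≤ j) (hyt : j ≤ y.2.1) : x = y := by
  by_contra hne
  exact hC.2 x hx y hy hne j hxs hxt ⟨hys, hyt⟩

/-- If feasible schedules `X` and `Y` on `[a,b]` satisfy (i) if `X` is
nonempty then some assignment interval of `Y` starts no later than every assignment
interval of `X` (i.e. the smallest start time of `Y` is at most that of `X`);
(ii) whenever the start time of an interval of `Y` lies in an interval of `X`, the
interval of `Y` ends no earlier; (iii) whenever a time step `u ∈ [a,b]` is covered by
`X` it is also covered by `Y`; then every prefix stability value of `X` is at most the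
corresponding prefix stability value of `Y`. -/
theorem stability_dominance {P : Type*} [Fintype P] (Δ : ℝ) (hΔ : 0 ≤ Δ)
    (L : ℕ → Finset P) (a b : ℕ) (hab : a ≤ b)
    (X Y : Finset (ℕ × ℕ × P)) (hX : Feasible L a b X) (hY : Feasible L a b Y)
    (h1 : X.Nonempty → ∃ y ∈ Y, ∀ x ∈ X, y.1 ≤ x.1)
    (h2 : ∀ y ∈ Y, ∀ x ∈ X, x.1 ≤ y.1 → y.1 ≤ x.2.1 → x.2.1 ≤ y.2.1)
    (h3 : ∀ u, a ≤ u → u ≤ b → (∃ x ∈ X, x.1 ≤ u ∧ u ≤ x.2.1) →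
      ∃ y ∈ Y, y.1 ≤ u ∧ u ≤ y.2.1) :
    ∀ j ≤ b - a, stab Δ X a (a + j) ≤ stab Δ Y a (a + j) := by
  intro j hj
  unfold stab
  refine mul_le_mul_of_nonneg_left (Nat.cast_le.2 ?_) hΔ
  rw [← Finset.card_sdiff_le_card_sdiff_iff]
  -- A step `t` counted only for `X` is the end of an interval `y` of `Y` that starts before the
  -- interval `x` of `X` around `t`; match it with the step `x.1 - 1`, counted only for `Y`.
  refine Finset.card_le_card_of_forall_subsingleton
    (fun t v => ∃ y ∈ Y, y.1 ≤ v ∧ v + 1 ≤ y.2.1 ∧ y.2.1 = t) ?_ ?_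
  · intro t ht
    simp only [Finset.mem_sdiff, Finset.mem_filter, Finset.mem_Ico] at ht
    obtain ⟨⟨htm, x, hx, hxs, hxt⟩, hnot⟩ := ht
    obtain ⟨y, hy, hys, hyt⟩ := h3 t htm.1 (by omega) ⟨x, hx, hxs, by omega⟩
    have hend : y.2.1 = t := by
      by_contra hne
      exact hnot ⟨htm, y, hy, hys, by omega⟩
    have hlt : y.1 < x.1 := by
      by_contra! hle
      have := h2 y hy x hx hle (by omega)
      omega
    have hya := (hY.1 y hy).1
    refine ⟨x.1 - 1, ?_, y, hy, by omega, by omega, hend⟩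
    simp only [Finset.mem_sdiff, Finset.mem_filter, Finset.mem_Ico]
    refine ⟨⟨by omega, y, hy, by omega, by omega⟩, ?_⟩
    rintro ⟨-, z, hz, hzs, hzt⟩
    have hzx : z = x :=
      hX.eq_of_mem hz hx (j := x.1) (by omega) (by omega) le_rfl (by omega)
    subst hzx
    omega
  · rintro v - t ⟨-, y, hy, hys, hyt, rfl⟩ t' ⟨-, z, hz, hzs, hzt, rfl⟩
    rw [hY.eq_of_mem hy hz (j := v) hys (by omega) hzs (by omega)]
end

section
/- For all natural numbers a ≤ b, the greedy schedule G = G(L,a,b) is a feasible schedule on [a,b], and for every feasible schedule X on [a,b] and every natural number j with 0 ≤ j ≤ b − a, λ(X, a, a+j) ≤ λ(G, a, a+j); in particular, G maximizes the stability value simultaneously over all prefixes of [a,b]. -/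
open scoped Classical

/-- Helper for the greedy schedule, with an explicit fuel parameter (the fuel
`b + 1 - a` used below always suffices, since each step advances `i` by at least one). -/
noncomputable def greedyAux {P : Type*} (L : ℕ → Finset P) (b : ℕ) :
    ℕ → ℕ → Finset (ℕ × ℕ × P)
  | 0, _ => ∅
  | fuel + 1, i =>
    if i ≤ b then
      if hL : (L i).Nonempty then
        let kOf : P → ℕ := fun q =>
          ((Finset.Icc i b).filter fun k => ∀ j ∈ Finset.Icc i k, q ∈ L j).sup id
        let p := (Finset.exists_max_image (L i) kOf hL).choose
        insert (i, kOf p, p) (greedyAux L b fuel (kOf p + 1))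
      else greedyAux L b fuel (i + 1)
    else ∅

/-- The greedy schedule `G(L,a,b)`: starting at `i = a`, if `L i = ∅` advance to `i + 1`;
otherwise choose `p ∈ L i` maximizing `k_p = max {k : i ≤ k ≤ b ∧ ∀ j ∈ [i,k], p ∈ L j}`,
add the assignment interval `(i, k_p, p)` and continue from `k_p + 1`; stop when `i > b`. -/
noncomputable def greedy {P : Type*} (L : ℕ → Finset P) (a b : ℕ) : Finset (ℕ × ℕ × P) :=
  greedyAux L b (b + 1 - a) a

/-- One step of the greedy recursion at a time step where some player is allowed: it adds an
allowed interval starting at `i` whose end is maximal among all such intervals. -/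
theorem greedyAux_succ_of_nonempty {P : Type*} (L : ℕ → Finset P) {b i : ℕ} (n : ℕ)
    (hi : i ≤ b) (hL : (L i).Nonempty) :
    ∃ p k, i ≤ k ∧ k ≤ b ∧ (∀ j, i ≤ j → j ≤ k → p ∈ L j) ∧
      (∀ q k', i ≤ k' → k' ≤ b → (∀ j, i ≤ j → j ≤ k' → q ∈ L j) → k' ≤ k) ∧
      greedyAux L b (n + 1) i = insert (i, k, p) (greedyAux L b n (k + 1)) := by
  let kOf : P → ℕ := fun q =>
    ((Finset.Icc i b).filter fun k => ∀ j ∈ Finset.Icc i k, q ∈ L j).sup id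
  have le_kOf : ∀ q k', i ≤ k' → k' ≤ b → (∀ j, i ≤ j → j ≤ k' → q ∈ L j) → k' ≤ kOf q := by
    intro q k' h1 h2 h3
    refine Finset.le_sup (f := id) (Finset.mem_filter.2 ⟨Finset.mem_Icc.2 ⟨h1, h2⟩, ?_⟩)
    intro j hj
    exact h3 j (Finset.mem_Icc.1 hj).1 (Finset.mem_Icc.1 hj).2
  have kOf_mem : ∀ q ∈ L i,
      kOf q ∈ (Finset.Icc i b).filter fun k => ∀ j ∈ Finset.Icc i k, q ∈ L j := by
    intro q hq
    have hne : ((Finset.Icc i b).filter fun k => ∀ j ∈ Finset.Icc i k, q ∈ L j).Nonempty := by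
      refine ⟨i, Finset.mem_filter.2 ⟨Finset.mem_Icc.2 ⟨le_rfl, hi⟩, ?_⟩⟩
      intro j hj
      simp only [Finset.Icc_self, Finset.mem_singleton] at hj
      exact hj ▸ hq
    obtain ⟨k, hk, hk'⟩ := Finset.exists_mem_eq_sup _ hne id
    simp only [kOf, hk']
    exact hk
  have hp := (Finset.exists_max_image (L i) kOf hL).choose_spec
  set p := (Finset.exists_max_image (L i) kOf hL).choose with hp_def
  have hk := kOf_mem p hp.1
  simp only [Finset.mem_filter, Finset.mem_Icc] at hk
  refine ⟨p, kOf p, hk.1.1, hk.1.2, fun j h1 h2 => hk.2 j ⟨h1, h2⟩, ?_, ?_⟩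
  · intro q k' h1 h2 h3
    exact (le_kOf q k' h1 h2 h3).trans (hp.2 q (h3 i le_rfl h1))
  · rw [greedyAux, if_pos hi, dif_pos hL]

theorem greedyAux_succ_of_eq_empty {P : Type*} (L : ℕ → Finset P) {b i : ℕ} (n : ℕ)
    (hi : i ≤ b) (hL : L i = ∅) :
    greedyAux L b (n + 1) i = greedyAux L b n (i + 1) := by
  rw [greedyAux, if_pos hi, dif_neg (by simp [hL])]

theorem Feasible.mono_left {P : Type*} {L : ℕ → Finset P} {a a' b : ℕ}
    {C : Finset (ℕ × ℕ × P)} (h : Feasible L a b C) (ha : a' ≤ a) : Feasible L a' b C :=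
  ⟨fun x hx => ⟨ha.trans (h.1 x hx).1, (h.1 x hx).2⟩, h.2⟩

protected theorem Feasible.insert {P : Type*} {L : ℕ → Finset P} {i k b : ℕ} {p : P}
    {C : Finset (ℕ × ℕ × P)} (h : Feasible L (k + 1) b C) (hik : i ≤ k) (hkb : k ≤ b)
    (hp : ∀ j, i ≤ j → j ≤ k → p ∈ L j) : Feasible L i b (insert (i, k, p) C) := by
  constructor
  · intro x hx
    rcases Finset.mem_insert.1 hx with rfl | hx
    · exact ⟨le_rfl, hik, hkb, hp⟩
    · have h' := h.1 x hx
      exact ⟨by omega, h'.2⟩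
  · intro x hx y hy hxy j h1 h2 h3
    rcases Finset.mem_insert.1 hx with rfl | hx <;> rcases Finset.mem_insert.1 hy with rfl | hy
    · exact hxy rfl
    · have := (h.1 y hy).1
      simp only at h1 h2
      omega
    · have := (h.1 x hx).1
      simp only at h3
      omega
    · exact h.2 x hx y hy hxy j h1 h2 h3

theorem greedyAux_feasible {P : Type*} (L : ℕ → Finset P) (b n i : ℕ) :
    Feasible L i b (greedyAux L b n i) := by
  induction n generalizing i with
  | zero => simp [greedyAux, Feasible]
  | succ n ih =>
    by_cases hi : i ≤ b
    · rcases (L i).eq_empty_or_nonempty with hL | hL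
      · rw [greedyAux_succ_of_eq_empty L n hi hL]
        exact (ih (i + 1)).mono_left i.le_succ
      · obtain ⟨p, k, hik, hkb, hp, -, h⟩ := greedyAux_succ_of_nonempty L n hi hL
        rw [h]
        exact (ih (k + 1)).insert hik hkb hp
    · rw [greedyAux, if_neg hi]
      simp [Feasible]

/-- No change of assignment interval takes place between the time steps `t` and `t + 1`. -/
def StableAt {P : Type*} (C : Finset (ℕ × ℕ × P)) (t : ℕ) : Prop :=
  ∃ x ∈ C, x.1 ≤ t ∧ t + 1 ≤ x.2.1

theorem StableAt.mono {P : Type*} {C D : Finset (ℕ × ℕ × P)} (h : C ⊆ D) {t : ℕ}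
    (ht : StableAt C t) : StableAt D t :=
  let ⟨x, hx, hxt⟩ := ht
  ⟨x, h hx, hxt⟩

/-- In a feasible schedule, consecutive stable time steps belong to a single interval. -/
theorem Feasible.exists_interval_of_stableAt {P : Type*} {L : ℕ → Finset P} {a b : ℕ}
    {X : Finset (ℕ × ℕ × P)} (hX : Feasible L a b X) {i k : ℕ} (hik : i ≤ k)
    (h : ∀ t, i ≤ t → t ≤ k → StableAt X t) : ∃ x ∈ X, x.1 ≤ i ∧ k + 1 ≤ x.2.1 := by
  induction k, hik using Nat.le_induction with
  | base => exact h i le_rfl le_rfl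
  | succ k hik ih =>
    obtain ⟨x, hx, hxi, hxk⟩ := ih fun t h1 h2 => h t h1 (h2.trans k.le_succ)
    obtain ⟨y, hy, hy1, hy2⟩ := h (k + 1) (hik.trans k.le_succ) le_rfl
    have hxy : x = y := by
      by_contra hne
      exact hX.2 x hx y hy hne (k + 1) (by omega) hxk ⟨hy1, by omega⟩
    exact ⟨x, hx, hxi, hxy ▸ hy2⟩

theorem card_filter_Ico_split (p : ℕ → Prop) {i m c : ℕ} (him : i ≤ m) (hmc : m ≤ c) :
    ((Finset.Ico i c).filter p).card =
      ((Finset.Ico i m).filter p).card + ((Finset.Ico m c).filter p).card := by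
  rw [← Finset.Ico_union_Ico_eq_Ico him hmc, Finset.filter_union, Finset.card_union_of_disjoint]
  exact Finset.disjoint_filter_filter (Finset.Ico_disjoint_Ico_consecutive i m c)

theorem Feasible.card_stableAt_le_greedyAux {P : Type*} {L : ℕ → Finset P} {a b : ℕ}
    {X : Finset (ℕ × ℕ × P)} (hX : Feasible L a b X) {c : ℕ} (hc : c ≤ b) (n i : ℕ)
    (hn : b + 1 ≤ i + n) :
    ((Finset.Ico i c).filter (StableAt X)).card ≤
      ((Finset.Ico i c).filter (StableAt (greedyAux L b n i))).card := by
  induction n generalizing i with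
  | zero => simp [Finset.Ico_eq_empty_of_le (show c ≤ i by omega)]
  | succ n ih =>
    rcases le_or_gt c i with hci | hic
    · simp [Finset.Ico_eq_empty_of_le hci]
    have hi : i ≤ b := by omega
    rcases (L i).eq_empty_or_nonempty with hL | hL
    · rw [greedyAux_succ_of_eq_empty L n hi hL,
        card_filter_Ico_split _ i.le_succ hic, card_filter_Ico_split _ i.le_succ hic]
      refine add_le_add ?_ (ih (i + 1) (by omega))
      suffices ¬ StableAt X i by simp [Finset.filter_singleton, this]
      rintro ⟨x, hx, h1, h2⟩
      have := (hX.1 x hx).2.2.2 i h1 (by omega)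
      simp [hL] at this
    · obtain ⟨p, k, hik, hkb, -, hmax, hG⟩ := greedyAux_succ_of_nonempty L n hi hL
      rw [hG]
      set G := greedyAux L b n (k + 1)
      have hstable : ∀ t, i ≤ t → t < k → StableAt (insert (i, k, p) G) t := fun t h1 h2 =>
        ⟨(i, k, p), Finset.mem_insert_self _ _, h1, h2⟩
      rcases le_or_gt c k with hck | hkc
      · rw [Finset.filter_true_of_mem (p := StableAt (insert (i, k, p) G))]
        · exact Finset.card_filter_le _ _
        · intro t ht
          rw [Finset.mem_Ico] at ht
          exact hstable t ht.1 (by omega)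
      · rw [card_filter_Ico_split _ (show i ≤ k + 1 by omega) hkc,
          card_filter_Ico_split _ (show i ≤ k + 1 by omega) hkc]
        refine add_le_add ?_ ((ih (k + 1) (by omega)).trans ?_)
        · have hlow : k - i ≤
              ((Finset.Ico i (k + 1)).filter (StableAt (insert (i, k, p) G))).card := by
            rw [← Nat.card_Ico]
            refine Finset.card_le_card fun t ht => ?_
            rw [Finset.mem_Ico] at ht
            exact Finset.mem_filter.2 ⟨Finset.mem_Ico.2 ⟨ht.1, by omega⟩, hstable t ht.1 ht.2⟩
          have hunstable : ∃ t ∈ Finset.Ico i (k + 1), ¬ StableAt X t := by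
            by_contra! hall
            obtain ⟨x, hx, h1, h2⟩ := hX.exists_interval_of_stableAt hik fun t h1 h2 =>
              hall t (Finset.mem_Ico.2 ⟨h1, by omega⟩)
            have := hmax x.2.2 (k + 1) (by omega) (by omega) fun j hj hjk =>
              (hX.1 x hx).2.2.2 j (by omega) (by omega)
            omega
          have hlt := Finset.card_lt_card (Finset.filter_ssubset.2 hunstable)
          rw [Nat.card_Ico] at hlt
          omega
        · refine Finset.card_le_card (Finset.monotone_filter_right _ fun t _ ht => ?_)
          exact StableAt.mono (Finset.subset_insert _ _) ht

/-- the greedy schedule `G(L,a,b)` is a feasible schedule on `[a,b]` and it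
simultaneously maximizes the stability value over all prefixes of `[a,b]`: for every
feasible schedule `X` on `[a,b]` and every `j ≤ b - a`,
`λ(X, a, a+j) ≤ λ(G, a, a+j)`. -/
theorem greedy_feasible_and_optimal {P : Type*} [Fintype P] (Δ : ℝ) (hΔ : 0 ≤ Δ)
    (L : ℕ → Finset P) (a b : ℕ) (hab : a ≤ b) :
    Feasible L a b (greedy L a b) ∧
    ∀ X : Finset (ℕ × ℕ × P), Feasible L a b X →
      ∀ j ≤ b - a, stab Δ X a (a + j) ≤ stab Δ (greedy L a b) a (a + j) := by
  refine ⟨greedyAux_feasible L b _ a, fun X hX j hj => ?_⟩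
  refine mul_le_mul_of_nonneg_left (Nat.cast_le.2 ?_) hΔ
  convert hX.card_stableAt_le_greedyAux (c := a + j) (by omega) (b + 1 - a) a (by omega) <;> rfl
end

section
/- For all natural numbers a ≤ b and every time step u with a ≤ u ≤ b, some assignment interval of the greedy schedule G(L,a,b) contains u if and only if L u ≠ ∅. -/
open scoped Classical

/-- The last time step `k ∈ [i, b]` such that `q` is admissible throughout `[i, k]`. -/
noncomputable def runEnd {P : Type*} (L : ℕ → Finset P) (b i : ℕ) (q : P) : ℕ :=
  ((Finset.Icc i b).filter fun k => ∀ j ∈ Finset.Icc i k, q ∈ L j).sup id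

theorem runEnd_spec {P : Type*} {L : ℕ → Finset P} {b i : ℕ} {q : P} (hib : i ≤ b)
    (hq : q ∈ L i) : i ≤ runEnd L b i q ∧ ∀ j ∈ Finset.Icc i (runEnd L b i q), q ∈ L j := by
  have hne : ((Finset.Icc i b).filter fun k => ∀ j ∈ Finset.Icc i k, q ∈ L j).Nonempty :=
    ⟨i, by simpa [hib] using fun j hij hji => le_antisymm hij hji ▸ hq⟩
  obtain ⟨k, hk, hsup⟩ := Finset.exists_mem_eq_sup _ hne id
  have hk' : runEnd L b i q = k := hsup
  rw [hk']
  rw [Finset.mem_filter, Finset.mem_Icc] at hk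
  exact ⟨hk.1.1, hk.2⟩

theorem exists_greedyAux_succ_eq_insert {P : Type*} {L : ℕ → Finset P} {b i : ℕ} (fuel : ℕ)
    (hib : i ≤ b) (hL : (L i).Nonempty) :
    ∃ p ∈ L i, greedyAux L b (fuel + 1) i =
      insert (i, runEnd L b i p, p) (greedyAux L b fuel (runEnd L b i p + 1)) := by
  refine ⟨_, (Finset.exists_max_image (L i) (runEnd L b i) hL).choose_spec.1, ?_⟩
  rw [greedyAux, if_pos hib, dif_pos hL]
  rfl

theorem greedyAux_succ_of_not_nonempty {P : Type*} {L : ℕ → Finset P} {b i : ℕ} (fuel : ℕ)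
    (hib : i ≤ b) (hL : ¬(L i).Nonempty) :
    greedyAux L b (fuel + 1) i = greedyAux L b fuel (i + 1) := by
  rw [greedyAux, if_pos hib, dif_neg hL]

theorem mem_of_mem_greedyAux {P : Type*} {L : ℕ → Finset P} {b fuel i u : ℕ} {x : ℕ × ℕ × P}
    (hx : x ∈ greedyAux L b fuel i) (hxu : x.1 ≤ u) (hux : u ≤ x.2.1) : x.2.2 ∈ L u := by
  induction fuel generalizing i with
  | zero => simp [greedyAux] at hx
  | succ fuel ih =>
    by_cases hib : i ≤ b
    · by_cases hL : (L i).Nonempty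
      · obtain ⟨p, hp, heq⟩ := exists_greedyAux_succ_eq_insert fuel hib hL
        rw [heq, Finset.mem_insert] at hx
        rcases hx with rfl | hx
        · exact (runEnd_spec hib hp).2 u (Finset.mem_Icc.2 ⟨hxu, hux⟩)
        · exact ih hx
      · exact ih (greedyAux_succ_of_not_nonempty fuel hib hL ▸ hx)
    · simp [greedyAux, hib] at hx

theorem exists_mem_greedyAux {P : Type*} {L : ℕ → Finset P} {b fuel i u : ℕ}
    (hfuel : b + 1 - i ≤ fuel) (hiu : i ≤ u) (hub : u ≤ b) (hu : (L u).Nonempty) :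
    ∃ x ∈ greedyAux L b fuel i, x.1 ≤ u ∧ u ≤ x.2.1 := by
  induction fuel generalizing i with
  | zero => omega
  | succ fuel ih =>
    have hib : i ≤ b := hiu.trans hub
    by_cases hL : (L i).Nonempty
    · obtain ⟨p, hp, heq⟩ := exists_greedyAux_succ_eq_insert fuel hib hL
      have hi := (runEnd_spec hib hp).1
      rw [heq]
      rcases le_or_gt u (runEnd L b i p) with h | h
      · exact ⟨_, Finset.mem_insert_self _ _, hiu, h⟩
      · obtain ⟨x, hx, hxu⟩ := ih (i := runEnd L b i p + 1) (by omega) h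
        exact ⟨x, Finset.mem_insert_of_mem hx, hxu⟩
    · rw [greedyAux_succ_of_not_nonempty fuel hib hL]
      have hne : i ≠ u := fun h => hL (h ▸ hu)
      exact ih (by omega) (by omega)

/-- for `a ≤ b` and every time step `u ∈ [a,b]`, some assignment interval of
the greedy schedule `G(L,a,b)` contains `u` if and only if `L u ≠ ∅`. -/
theorem greedy_covers_iff {P : Type*} [Fintype P] (L : ℕ → Finset P) (a b u : ℕ)
    (hab : a ≤ b) (hau : a ≤ u) (hub : u ≤ b) :
    (∃ x ∈ greedy L a b, x.1 ≤ u ∧ u ≤ x.2.1) ↔ L u ≠ ∅ := by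
  rw [← Finset.nonempty_iff_ne_empty]
  constructor
  · rintro ⟨x, hx, hxu, hux⟩
    exact ⟨x.2.2, mem_of_mem_greedyAux hx hxu hux⟩
  · exact exists_mem_greedyAux le_rfl hau hub
end

section
/- Let a ≤ b be natural numbers, let X be a feasible schedule on [a,b], and let (i,k,p) be an assignment interval of the greedy schedule G(L,a,b). If (s',t',p') is an assignment interval of X with s' ≤ i ≤ t', then k ≥ t'. -/
open scoped Classical

/-- Every greedy interval starting at `i` reaches at least as far as any player can be
assigned without interruption from `i` on. -/
theorem le_of_mem_greedyAux {P : Type*} (L : ℕ → Finset P) (b : ℕ) {i k t : ℕ} {p q : P}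
    (hit : i ≤ t) (htb : t ≤ b) (hq : ∀ j, i ≤ j → j ≤ t → q ∈ L j) (fuel i₀ : ℕ)
    (hG : (i, k, p) ∈ greedyAux L b fuel i₀) : t ≤ k := by
  induction fuel generalizing i₀ with
  | zero => simp [greedyAux] at hG
  | succ fuel ih =>
    rw [greedyAux] at hG
    split_ifs at hG with hb hL
    · obtain h | h := Finset.mem_insert.mp hG
      · simp only [Prod.mk.injEq] at h
        obtain ⟨rfl, rfl, -⟩ := h
        refine le_trans ?_ ((Finset.exists_max_image (L i) (fun r : P =>
          ((Finset.Icc i b).filter fun k => ∀ j ∈ Finset.Icc i k, r ∈ L j).sup id) hL).choose_spec.2 q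
          (hq i le_rfl hit))
        refine Finset.le_sup (f := id) (b := t) (Finset.mem_filter.mpr
          ⟨Finset.mem_Icc.mpr ⟨hit, htb⟩, fun j hj => ?_⟩)
        exact hq j (Finset.mem_Icc.mp hj).1 (Finset.mem_Icc.mp hj).2
      · exact ih _ h
    · exact ih _ hG
    · simp at hG

/-- if `(i,k,p)` is an assignment interval of the greedy schedule `G(L,a,b)`
and `(s',t',p')` is an assignment interval of a feasible schedule `X` on `[a,b]` with
`s' ≤ i ≤ t'`, then `k ≥ t'`. -/
theorem greedy_interval_extends {P : Type*} [Fintype P] (L : ℕ → Finset P) (a b : ℕ)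
    (hab : a ≤ b) (X : Finset (ℕ × ℕ × P)) (hX : Feasible L a b X)
    (i k : ℕ) (p : P) (hG : (i, k, p) ∈ greedy L a b)
    (s' t' : ℕ) (p' : P) (hx : (s', t', p') ∈ X) (hsi : s' ≤ i) (hit : i ≤ t') :
    t' ≤ k := by
  obtain ⟨-, -, htb, hp⟩ := hX.1 _ hx
  exact le_of_mem_greedyAux L b hit htb (fun j hj => hp j (hsi.trans hj)) _ _ hG
end

section
/- For every assignment interval (i,k,p) of the greedy schedule G(L,a,b) with k < b, there is no player q ∈ P with q ∈ L j for all j with i ≤ j ≤ k+1; that is, each greedy assignment interval extends as far to the right as any single player's availability allows. -/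
open scoped Classical

theorem greedyAux_not_extendable {P : Type*} (L : ℕ → Finset P) (b fuel s i k : ℕ) (p : P)
    (hG : (i, k, p) ∈ greedyAux L b fuel s) (hk : k < b) :
    ¬ ∃ q : P, ∀ j, i ≤ j → j ≤ k + 1 → q ∈ L j := by
  induction fuel generalizing s with
  | zero => simp [greedyAux] at hG
  | succ fuel ih =>
    rw [greedyAux] at hG
    split_ifs at hG with hs hL
    · set kOf : P → ℕ := fun q =>
        ((Finset.Icc s b).filter fun k => ∀ j ∈ Finset.Icc s k, q ∈ L j).sup id
      have le_kOf : ∀ q m, s ≤ m → m ≤ b → (∀ j, s ≤ j → j ≤ m → q ∈ L j) → m ≤ kOf q := by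
        intro q m hsm hmb hq
        refine Finset.le_sup (f := id) (Finset.mem_filter.2 ⟨Finset.mem_Icc.2 ⟨hsm, hmb⟩, ?_⟩)
        intro j hj
        exact hq j (Finset.mem_Icc.1 hj).1 (Finset.mem_Icc.1 hj).2
      obtain ⟨hpL, hmax⟩ := (Finset.exists_max_image (L s) kOf hL).choose_spec
      rcases Finset.mem_insert.1 hG with h | h
      · obtain ⟨rfl, rfl, rfl⟩ : i = s ∧ k = _ ∧ p = _ := by simpa only [Prod.mk.injEq] using h
        rintro ⟨q, hq⟩
        have hi := le_kOf _ i le_rfl hs fun j h₁ h₂ => by rwa [le_antisymm h₂ h₁]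
        have hext := le_kOf q _ (hi.trans (Nat.le_succ _)) hk hq
        have hle := hmax q (hq i le_rfl (hi.trans (Nat.le_succ _)))
        omega
      · exact ih _ h
    · exact ih _ hG
    · simp at hG

/-- every assignment interval `(i,k,p)` of the greedy schedule `G(L,a,b)`
with `k < b` cannot be extended: no single player `q` is available at every time step
`j ∈ [i, k+1]`. -/
theorem greedy_interval_maximal {P : Type*} [Fintype P] (L : ℕ → Finset P) (a b : ℕ)
    (i k : ℕ) (p : P) (hG : (i, k, p) ∈ greedy L a b) (hk : k < b) :
    ¬ ∃ q : P, ∀ j, i ≤ j → j ≤ k + 1 → q ∈ L j := by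
  exact greedyAux_not_extendable L b _ a i k p hG hk
end

section
/- The function f(ρ) = ρ + 1 − √(ρ² + 2ρ) − 1/(4ρ+2) is strictly decreasing on the interval (0,1]; consequently, for every ρ ∈ (0,1], f(ρ) ≥ f(1) = 11/6 − √3. -/
theorem sqrt_mul_lt_of_pos {x : ℝ} (hx : 0 < x) :
    Real.sqrt (x ^ 2 + 2 * x) * ((2 * x + 1) ^ 2 + 1) < (x + 1) * (2 * x + 1) ^ 2 := by
  apply lt_of_pow_lt_pow_left₀ 2 (by positivity)
  rw [mul_pow, Real.sq_sqrt (by positivity)]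
  have h : 0 < 8 * x ^ 4 + 8 * x ^ 3 + 5 * x ^ 2 + 2 * x + 1 := by positivity
  linear_combination h

theorem hasDerivAt_add_one_sub_sqrt_sub_inv {x : ℝ} (hx : 0 < x) :
    HasDerivAt (fun ρ : ℝ => ρ + 1 - Real.sqrt (ρ ^ 2 + 2 * ρ) - 1 / (4 * ρ + 2))
      (1 - (x + 1) / Real.sqrt (x ^ 2 + 2 * x) + 1 / (2 * x + 1) ^ 2) x := by
  have hpos : 0 < x ^ 2 + 2 * x := by positivity
  have hsqrt := (((hasDerivAt_id x).pow 2).add ((hasDerivAt_id x).const_mul 2)).sqrt hpos.ne'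
  have hlin := ((hasDerivAt_id x).const_mul 4).add_const 2
  have hinv := (hasDerivAt_const x (1 : ℝ)).div hlin
    (show 4 * x + 2 ≠ 0 by positivity)
  refine ((((hasDerivAt_id x).add_const 1).sub hsqrt).sub hinv).congr_deriv ?_
  have hs : Real.sqrt (x ^ 2 + 2 * x) ≠ 0 := (Real.sqrt_pos.2 hpos).ne'
  simp only [id, Pi.add_apply, Pi.pow_apply]
  rw [show 4 * x + 2 = 2 * (2 * x + 1) by ring]
  field_simp
  ring

/-- the function `f(ρ) = ρ + 1 − √(ρ² + 2ρ) − 1/(4ρ+2)` is strictly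
decreasing on `(0,1]`; consequently, for every `ρ ∈ (0,1]`, `f ρ ≥ f 1 = 11/6 − √3`. -/
theorem f_strictAntiOn :
    StrictAntiOn (fun ρ : ℝ => ρ + 1 - Real.sqrt (ρ ^ 2 + 2 * ρ) - 1 / (4 * ρ + 2))
      (Set.Ioc 0 1) ∧
    (∀ ρ ∈ Set.Ioc (0 : ℝ) 1,
      ρ + 1 - Real.sqrt (ρ ^ 2 + 2 * ρ) - 1 / (4 * ρ + 2) ≥ 11 / 6 - Real.sqrt 3) ∧
    (1 : ℝ) + 1 - Real.sqrt ((1 : ℝ) ^ 2 + 2 * 1) - 1 / (4 * 1 + 2) = 11 / 6 - Real.sqrt 3 := by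
  have hanti : StrictAntiOn
      (fun ρ : ℝ => ρ + 1 - Real.sqrt (ρ ^ 2 + 2 * ρ) - 1 / (4 * ρ + 2)) (Set.Ioc 0 1) := by
    refine strictAntiOn_of_deriv_neg (convex_Ioc 0 1) (fun x hx =>
      (hasDerivAt_add_one_sub_sqrt_sub_inv hx.1).continuousAt.continuousWithinAt) fun x hx => ?_
    have hx0 : 0 < x := (interior_subset hx).1
    rw [(hasDerivAt_add_one_sub_sqrt_sub_inv hx0).deriv]
    have hs : 0 < Real.sqrt (x ^ 2 + 2 * x) := Real.sqrt_pos.2 (by positivity)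
    have key : 1 + 1 / (2 * x + 1) ^ 2 < (x + 1) / Real.sqrt (x ^ 2 + 2 * x) := by
      rw [one_add_div (by positivity), div_lt_div_iff₀ (by positivity) hs, mul_comm]
      exact sqrt_mul_lt_of_pos hx0
    linarith
  have hone : (1 : ℝ) + 1 - Real.sqrt ((1 : ℝ) ^ 2 + 2 * 1) - 1 / (4 * 1 + 2)
      = 11 / 6 - Real.sqrt 3 := by
    rw [show (1 : ℝ) ^ 2 + 2 * 1 = 3 by norm_num]
    ring
  exact ⟨hanti, fun ρ hρ => hone.ge.trans
    (hanti.antitoneOn hρ (Set.right_mem_Ioc.2 one_pos) hρ.2), hone⟩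
end

section
/- For every real ρ with 0 < ρ ≤ 1, (ρ + 1 − √(ρ² + 2ρ))·ρ > ρ/(4ρ+2) + ρ/10; that is, the competitive ratio of the 1-lookahead algorithm exceeds ρ/(4ρ+2) + ρ/10. -/
/-- for `0 < ρ ≤ 1`, the competitive ratio `(ρ + 1 − √(ρ² + 2ρ))·ρ` of the
1-lookahead algorithm exceeds `ρ/(4ρ+2) + ρ/10`. -/
theorem competitive_ratio_improvement (ρ : ℝ) (hρ : 0 < ρ) (hρ1 : ρ ≤ 1) :
    (ρ + 1 - Real.sqrt (ρ ^ 2 + 2 * ρ)) * ρ > ρ / (4 * ρ + 2) + ρ / 10 := by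
  have hd : 0 < 4 * ρ + 2 := by positivity
  have hsqrt : Real.sqrt (ρ ^ 2 + 2 * ρ) < (4 * ρ ^ 2 + 28 / 5 * ρ + 4 / 5) / (4 * ρ + 2) := by
    rw [Real.sqrt_lt' (by positivity), div_pow, lt_div_iff₀ (by positivity)]
    nlinarith [mul_nonneg hρ.le (sub_nonneg.2 hρ1),
      mul_nonneg (sq_nonneg ρ) (sub_nonneg.2 hρ1)]
  have hsplit : (4 * ρ ^ 2 + 28 / 5 * ρ + 4 / 5) / (4 * ρ + 2)
      = ρ + 1 - (1 / (4 * ρ + 2) + 1 / 10) := by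
    field_simp
    ring
  calc ρ / (4 * ρ + 2) + ρ / 10 = (1 / (4 * ρ + 2) + 1 / 10) * ρ := by ring
    _ < (ρ + 1 - Real.sqrt (ρ ^ 2 + 2 * ρ)) * ρ :=
      mul_lt_mul_of_pos_right (by linarith) hρ
end
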